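/- Let A, B ∈ M_k(ℂ) be positive matrices with Tr(A) = Tr(B) = 1, and let F_A, F_B : C(T) → B_k be the conditional expectations defined by F_A = π_k⁻¹ ∘ (Tr(A ·)·I) ∘ π_k. Then F_A = F_B if and only if tr_l(A) = tr_l(B) for every l = 1, ..., k-1, where tr_l(C) = Σ_{j=1}^{k-l} c_{j,l+j}. -/

import Mathlib

open scoped ComplexOrder

/-- The character `z ↦ z^n` on the unit circle, as a continuous function. -/
noncomputable def circleChar (n : ℤ) : C(Circle, ℂ) :=
  ⟨fun z => ((z ^ n : Circle) : ℂ), continuous_subtype_val.comp (continuous_zpow n)⟩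

/-- The shift-type matrix `U_k ∈ M_k(C(𝕋))`. -/
noncomputable def shiftUnitary (k : ℕ) : Matrix (Fin k) (Fin k) C(Circle, ℂ) :=
  fun i j =>
    if (i : ℕ) = 0 ∧ (j : ℕ) = k - 1 then ⟨fun z => (z : ℂ), continuous_subtype_val⟩
    else if (i : ℕ) = (j : ℕ) + 1 then 1 else 0

/-- The `l`-trace of a `k × k` matrix: the sum of its `l`-th upper diagonal. -/
noncomputable def ltrace {k : ℕ} (l : ℕ) (C : Matrix (Fin k) (Fin k) ℂ) : ℂ :=
  ∑ j : Fin k, if h : (j : ℕ) + l < k then C j ⟨(j : ℕ) + l, h⟩ else 0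

/-- `E` is a conditional expectation of `C(𝕋)` onto the C*-subalgebra `B`. -/
def IsCondExp (B : StarSubalgebra ℂ C(Circle, ℂ)) (E : C(Circle, ℂ) → C(Circle, ℂ)) : Prop :=
  IsLinearMap ℂ E ∧ (∀ g, E g ∈ B) ∧ (∀ b ∈ B, E b = b) ∧
    (∀ g, ∃ h : C(Circle, ℂ), E (star g * g) = star h * h) ∧
    (∀ b₁ ∈ B, ∀ b₂ ∈ B, ∀ a, E (b₁ * a * b₂) = b₁ * E a * b₂) ∧
    (∀ g, ‖E g‖ ≤ ‖g‖)

theorem circleChar_zero : circleChar 0 = 1 := by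
  ext z; simp [circleChar]

theorem circleChar_add (m n : ℤ) : circleChar (m + n) = circleChar m * circleChar n := by
  ext z; simp [circleChar, zpow_add]

theorem star_circleChar (n : ℤ) : star (circleChar n) = circleChar (-n) := by
  ext z
  simp [circleChar, ← Circle.coe_inv_eq_conj]

theorem circleChar_natCast_mul (m : ℤ) (n : ℕ) : circleChar (m * n) = circleChar m ^ n := by
  ext z
  simp [circleChar, zpow_mul]

theorem circleChar_mul_mem_elemental (m q : ℤ) :
    circleChar (m * q) ∈ StarAlgebra.elemental ℂ (circleChar m) := by
  have hm := StarAlgebra.elemental.self_mem ℂ (circleChar m)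
  obtain ⟨n, rfl | rfl⟩ := q.eq_nat_or_neg
  · rw [circleChar_natCast_mul]
    exact pow_mem hm n
  · rw [mul_neg, ← star_circleChar, circleChar_natCast_mul]
    exact star_mem (pow_mem hm n)

/-- Trigonometric polynomials are dense in `C(𝕋)`. -/
theorem span_circleChar_topologicalClosure :
    (Submodule.span ℂ (Set.range circleChar)).topologicalClosure = ⊤ := by
  have hsep : (StarAlgebra.adjoin ℂ {circleChar 1}).toSubalgebra.SeparatesPoints := by
    intro x y hxy
    refine ⟨circleChar 1, ⟨circleChar 1, StarAlgebra.subset_adjoin ℂ _ rfl, rfl⟩, ?_⟩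
    simpa [circleChar, Circle.coe_inj] using hxy
  have htop := ContinuousMap.starSubalgebra_topologicalClosure_eq_top_of_separatesPoints _ hsep
  have hclosure : Submonoid.closure ({circleChar 1} ∪ star {circleChar 1}) ≤
      (⟨⟨Set.range circleChar, by
        rintro _ _ ⟨m, rfl⟩ ⟨n, rfl⟩
        exact ⟨m + n, circleChar_add m n⟩⟩, ⟨0, circleChar_zero⟩⟩ :
        Submonoid C(Circle, ℂ)) := by
    rw [Submonoid.closure_le]
    rintro g (hg | hg)
    · exact ⟨1, hg.symm⟩
    · refine ⟨-1, ?_⟩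
      rw [← star_circleChar, ← Set.mem_singleton_iff.mp (Set.mem_star.mp hg), star_star]
  have hspan : ((StarAlgebra.adjoin ℂ {circleChar 1} : StarSubalgebra ℂ C(Circle, ℂ)) :
      Set C(Circle, ℂ)) ⊆ Submodule.span ℂ (Set.range circleChar) := by
    intro g hg
    have hg' : g ∈ Subalgebra.toSubmodule
        (Algebra.adjoin ℂ ({circleChar 1} ∪ star {circleChar 1})) := hg
    rw [Algebra.adjoin_eq_span] at hg'
    exact Submodule.span_mono hclosure hg'
  rw [eq_top_iff]
  intro g _
  have hg : g ∈ (StarAlgebra.adjoin ℂ {circleChar 1}).topologicalClosure := htop ▸ trivial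
  exact closure_mono hspan hg

theorem IsCondExp.continuous {B : StarSubalgebra ℂ C(Circle, ℂ)}
    {E : C(Circle, ℂ) → C(Circle, ℂ)} (hE : IsCondExp B E) : Continuous E :=
  (LinearMap.mkContinuous (hE.1.mk' E) 1 fun g => by simpa using hE.2.2.2.2.2 g).continuous

/-- Bounded conditional expectations onto the algebra generated by `z ↦ z ^ k` are determined by
their values on `z ^ l` for `0 < l < k`. -/
theorem IsCondExp.ext_of_circleChar {k : ℕ} (hk : 1 ≤ k) {E F : C(Circle, ℂ) → C(Circle, ℂ)}
    (hE : IsCondExp (StarAlgebra.elemental ℂ (circleChar (k : ℤ))) E)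
    (hF : IsCondExp (StarAlgebra.elemental ℂ (circleChar (k : ℤ))) F)
    (h : ∀ l : ℕ, 1 ≤ l → l < k → E (circleChar l) = F (circleChar l)) : E = F := by
  have hmul {G : C(Circle, ℂ) → C(Circle, ℂ)}
      (hG : IsCondExp (StarAlgebra.elemental ℂ (circleChar (k : ℤ))) G) (q : ℤ)
      (g : C(Circle, ℂ)) : G (circleChar (k * q) * g) = circleChar (k * q) * G g := by
    simpa using hG.2.2.2.2.1 _ (circleChar_mul_mem_elemental k q) 1 (one_mem _) g
  have hchar (n : ℤ) : E (circleChar n) = F (circleChar n) := by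
    have hk0 : (k : ℤ) ≠ 0 := by omega
    obtain ⟨r, hr⟩ := Int.eq_ofNat_of_zero_le (Int.emod_nonneg n hk0)
    have hrk : r < k := by
      have := Int.emod_lt_of_pos n (show (0 : ℤ) < k by omega)
      omega
    have hn : n = k * (n / k) + r := by rw [← hr, Int.mul_ediv_add_emod]
    rw [hn, circleChar_add, hmul hE, hmul hF]
    congr 1
    rcases Nat.eq_zero_or_pos r with rfl | hr0
    · rw [Nat.cast_zero, circleChar_zero, hE.2.2.1 1 (one_mem _), hF.2.2.1 1 (one_mem _)]
    · exact h r hr0 hrk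
  have hspan : Set.EqOn E F (Submodule.span ℂ (Set.range circleChar)) := by
    intro g hg
    refine LinearMap.eqOn_span (f := hE.1.mk' E) (g := hF.1.mk' F) ?_ hg
    rintro _ ⟨n, rfl⟩
    exact hchar n
  funext g
  have hg : g ∈ (Submodule.span ℂ (Set.range circleChar)).topologicalClosure :=
    span_circleChar_topologicalClosure ▸ trivial
  exact hspan.closure hE.continuous hF.continuous hg

theorem shiftUnitary_pow_apply {k l : ℕ} (hl : l ≤ k) (i j : Fin k) :
    (shiftUnitary k ^ l) i j =
      if (i : ℕ) = j + l then 1 else if (i : ℕ) + k = j + l then circleChar 1 else 0 := by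
  have hz : (⟨fun z => (z : ℂ), continuous_subtype_val⟩ : C(Circle, ℂ)) = circleChar 1 := by
    ext z
    change (z : ℂ) = _
    simp [circleChar]
  induction l generalizing j with
  | zero =>
    have hij : (i : ℕ) + k ≠ j := by omega
    simp [Matrix.one_apply, Fin.ext_iff, hij]
  | succ l ih =>
    rw [pow_succ, Matrix.mul_apply]
    by_cases hj : (j : ℕ) = k - 1
    · rw [Finset.sum_eq_single (⟨0, by omega⟩ : Fin k)]
      · rw [ih (by omega)]
        simp only [shiftUnitary, hz, hj]
        have h₁ : (i : ℕ) + k ≠ 0 + l := by omega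
        have h₂ : (i : ℕ) ≠ k - 1 + (l + 1) := by omega
        have h₃ : (i : ℕ) + k = k - 1 + (l + 1) ↔ (i : ℕ) = 0 + l := by omega
        simp only [h₁, h₂, h₃, and_self, if_true, if_false, ite_mul, one_mul, zero_mul]
      · intro m _ hm
        have hm0 : (m : ℕ) ≠ 0 := fun h => hm (Fin.ext h)
        have hmj : (m : ℕ) ≠ j + 1 := by omega
        simp [shiftUnitary, hm0, hmj]
      · simp
    · rw [Finset.sum_eq_single (⟨j + 1, by omega⟩ : Fin k)]
      · rw [ih (by omega)]
        simp [shiftUnitary, add_assoc, add_comm 1 l]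
      · intro m _ hm
        have hmj : (m : ℕ) ≠ j + 1 := fun h => hm (Fin.ext h)
        simp [shiftUnitary, hj, hmj]
      · simp

theorem sum_ite_eq_ltrace {k : ℕ} (l : ℕ) (C : Matrix (Fin k) (Fin k) ℂ) :
    ∑ i : Fin k, ∑ j : Fin k, (if (j : ℕ) = i + l then C i j else 0) = ltrace l C := by
  refine Finset.sum_congr rfl fun i _ => ?_
  split_ifs with h
  · rw [Finset.sum_eq_single (⟨i + l, h⟩ : Fin k)]
    · simp
    · intro j _ hj
      exact if_neg fun h' => hj (Fin.ext h')
    · simp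
  · exact Finset.sum_eq_zero fun j _ => if_neg (by omega)

theorem ltrace_transpose {k : ℕ} (l : ℕ) {C : Matrix (Fin k) (Fin k) ℂ} (hC : C.IsHermitian) :
    ltrace l C.transpose = star (ltrace l C) := by
  simp only [ltrace, star_sum, Matrix.transpose_apply]
  refine Finset.sum_congr rfl fun i _ => ?_
  split_ifs with h
  · exact (hC.apply _ _).symm
  · simp

theorem sum_smul_shiftUnitary_pow {k l : ℕ} (hl : 1 ≤ l) (hlk : l < k)
    {C : Matrix (Fin k) (Fin k) ℂ} (hC : C.IsHermitian) :
    ∑ i : Fin k, ∑ j : Fin k, C i j • (shiftUnitary k ^ l) j i =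
      ltrace l C • 1 + star (ltrace (k - l) C) • circleChar 1 := by
  rw [← ltrace_transpose _ hC, ← sum_ite_eq_ltrace, ← sum_ite_eq_ltrace,
    Finset.sum_comm (f := fun i j : Fin k => if (j : ℕ) = i + (k - l) then C.transpose i j else 0)]
  simp only [Finset.sum_smul, ← Finset.sum_add_distrib]
  refine Finset.sum_congr rfl fun i _ => Finset.sum_congr rfl fun j _ => ?_
  rw [shiftUnitary_pow_apply hlk.le, Matrix.transpose_apply]
  by_cases h₁ : (j : ℕ) = i + l
  · have h₂ : (i : ℕ) ≠ i + l + (k - l) := by omega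
    simp [h₁, h₂]
  · have h₂ : (j : ℕ) + k = i + l ↔ (i : ℕ) = j + (k - l) := by omega
    simp only [h₁, h₂, if_false, zero_smul, zero_add]
    split_ifs <;> simp

theorem eq_of_smul_one_add_smul_circleChar_eq {a b c d : ℂ}
    (h : a • (1 : C(Circle, ℂ)) + b • circleChar 1 = c • 1 + d • circleChar 1) : a = c := by
  have hz (z : Circle) : a + b * z = c + d * z := by
    have hz := DFunLike.congr_fun h z
    rw [ContinuousMap.add_apply, ContinuousMap.add_apply] at hz
    simpa only [circleChar, zpow_one, ContinuousMap.smul_apply, ContinuousMap.one_apply,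
      ContinuousMap.coe_mk, smul_eq_mul, mul_one] using hz
  have h₁ := hz 1
  have h₂ := hz (Circle.ofConjDivSelf Complex.I Complex.I_ne_zero)
  simp only [Circle.coe_one, Circle.ofConjDivSelf_coe, Complex.conj_I, neg_div,
    div_self Complex.I_ne_zero] at h₁ h₂
  linear_combination (h₁ + h₂) / 2

/-- The conditional expectations `F_A` and `F_B` coincide iff the `l`-traces of `A` and
`B` agree for `l = 1, …, k-1`. -/
theorem condExp_eq_iff_ltraces_eq (k : ℕ) (hk : 1 ≤ k)
    (A B : Matrix (Fin k) (Fin k) ℂ) (hA : A.PosSemidef) (hB : B.PosSemidef)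
    (htrA : A.trace = 1) (htrB : B.trace = 1)
    (hU : shiftUnitary k ∈ unitary (Matrix (Fin k) (Fin k) C(Circle, ℂ)))
    (π : C(Circle, ℂ) →⋆ₐ[ℂ] Matrix (Fin k) (Fin k) C(Circle, ℂ))
    (hπinj : Function.Injective π)
    (hπ : ∀ l : ℤ, π (circleChar l) =
      (((⟨shiftUnitary k, hU⟩ : unitary (Matrix (Fin k) (Fin k) C(Circle, ℂ))) ^ l :
        unitary (Matrix (Fin k) (Fin k) C(Circle, ℂ))) :
        Matrix (Fin k) (Fin k) C(Circle, ℂ)))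
    (FA FB : C(Circle, ℂ) → C(Circle, ℂ))
    (hFA : IsCondExp (StarAlgebra.elemental ℂ (circleChar (k : ℤ))) FA)
    (hFB : IsCondExp (StarAlgebra.elemental ℂ (circleChar (k : ℤ))) FB)
    (hFA' : ∀ g, π (FA g) = (∑ i : Fin k, ∑ j : Fin k, A i j • (π g) j i) •
      (1 : Matrix (Fin k) (Fin k) C(Circle, ℂ)))
    (hFB' : ∀ g, π (FB g) = (∑ i : Fin k, ∑ j : Fin k, B i j • (π g) j i) •
      (1 : Matrix (Fin k) (Fin k) C(Circle, ℂ))) :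
    FA = FB ↔ (∀ l : ℕ, 1 ≤ l → l ≤ k - 1 → ltrace l A = ltrace l B) := by
  have hpow (l : ℕ) : π (circleChar l) = shiftUnitary k ^ l := by
    simp [hπ l]
  constructor
  · intro hF l hl hlk
    have h : π (FA (circleChar l)) = π (FB (circleChar l)) := by rw [hF]
    rw [hFA', hFB', hpow, sum_smul_shiftUnitary_pow hl (by omega) hA.isHermitian,
      sum_smul_shiftUnitary_pow hl (by omega) hB.isHermitian] at h
    have h₀ := congrFun (congrFun h ⟨0, hk⟩) ⟨0, hk⟩
    rw [Matrix.smul_apply, Matrix.smul_apply, Matrix.one_apply_eq, smul_eq_mul, smul_eq_mul,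
      mul_one, mul_one] at h₀
    exact eq_of_smul_one_add_smul_circleChar_eq h₀
  · intro h
    refine hFA.ext_of_circleChar hk hFB fun l hl hlk => hπinj ?_
    rw [hFA', hFB', hpow, sum_smul_shiftUnitary_pow hl hlk hA.isHermitian,
      sum_smul_shiftUnitary_pow hl hlk hB.isHermitian, h l hl (by omega),
      h (k - l) (by omega) (by omega)]
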